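/- arXiv:2507.01366 — 6 statements merged into one kernel-verified Lean document; each statement's English description precedes it below -/
import Mathlib

section
/- Maxflow (Min+1)-cut Theorem: Let G be an undirected multigraph on V and f a maximum integral (s,t)-flow. An (s,t)-cut C has capacity λ + 1 if and only if exactly one edge across C carries no flow and every other edge across C carries one unit of flow from the C-side to the complement side; formally, c(C) = λ + 1 if and only if z_f(C) = 1 and f_in(C) = 0. -/
open Finset

section Defs

variable {V : Type*} [Fintype V] [DecidableEq V]

/-- Capacity of an `(s,t)`-cut `C` (sum of multiplicities of edges leaving `C`). -/
def capN (w : V → V → ℕ) (C : Finset V) : ℕ := ∑ u ∈ C, ∑ v ∈ Cᶜ, w u v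

/-- A cut `C` separates `a` and `b` if exactly one of them lies in `C`. -/
def Separates (C : Finset V) (a b : V) : Prop :=
  (a ∈ C ∧ b ∉ C) ∨ (b ∈ C ∧ a ∉ C)

/-- Flow leaving the cut `C`. -/
def flowOut (f : V → V → ℕ) (C : Finset V) : ℕ := ∑ u ∈ C, ∑ v ∈ Cᶜ, f u v

/-- Flow entering the cut `C`. -/
def flowIn (f : V → V → ℕ) (C : Finset V) : ℕ := ∑ u ∈ C, ∑ v ∈ Cᶜ, f v u

/-- Number of zero-flow edges across the cut `C`. -/
def zeroFlowCount (w f : V → V → ℕ) (C : Finset V) : ℕ :=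
  ∑ u ∈ C, ∑ v ∈ Cᶜ, (w u v - f u v - f v u)

/-- `{a, b}` is an anchor edge for the maximum flow `f`: some edge between `a` and `b`
carries no flow, and some `(λ+1)` `(s,t)`-cut separates `a` and `b`. -/
def IsAnchor (s t : V) (w f : V → V → ℕ) (lam : ℕ) (a b : V) : Prop :=
  a ≠ b ∧ 1 ≤ w a b - f a b - f b a ∧
    ∃ C : Finset V, s ∈ C ∧ t ∉ C ∧ capN w C = lam + 1 ∧ Separates C a b

end Defs

/-- Every edge across a cut carries flow out, flow in, or no flow. -/
theorem capN_eq_flowOut_add_flowIn_add_zeroFlowCount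
    {V : Type*} [Fintype V] [DecidableEq V] (w f : V → V → ℕ)
    (hflow : ∀ u v, f u v + f v u ≤ w u v) (C : Finset V) :
    capN w C = flowOut f C + flowIn f C + zeroFlowCount w f C := by
  simp only [capN, flowOut, flowIn, zeroFlowCount, ← sum_add_distrib]
  refine sum_congr rfl fun u _ => sum_congr rfl fun v _ => ?_
  have := hflow u v
  omega

/-- The net flow across an `(s,t)`-cut equals the net flow out of `s`. -/
theorem flowOut_eq_add_flowIn
    {V : Type*} [Fintype V] [DecidableEq V] {s t : V} {f : V → V → ℕ} {lam : ℕ}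
    (hcons : ∀ x, x ≠ s → x ≠ t → ∑ v, f x v = ∑ v, f v x)
    (hval : ∑ v, f s v = lam + ∑ v, f v s)
    {C : Finset V} (hCs : s ∈ C) (hCt : t ∉ C) :
    flowOut f C = lam + flowIn f C := by
  have hsum : ∑ u ∈ C, ∑ v, f u v = lam + ∑ u ∈ C, ∑ v, f v u := by
    rw [← add_sum_erase C _ hCs, ← add_sum_erase C (fun u => ∑ v, f v u) hCs, hval, add_assoc]
    congr 2
    refine sum_congr rfl fun x hx => hcons x (ne_of_mem_erase hx) ?_
    rintro rfl
    exact hCt (mem_of_mem_erase hx)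
  have hout : ∑ u ∈ C, ∑ v, f u v = ∑ u ∈ C, ∑ v ∈ C, f u v + flowOut f C := by
    simp only [flowOut, ← sum_add_distrib, sum_add_sum_compl]
  have hin : ∑ u ∈ C, ∑ v, f v u = ∑ u ∈ C, ∑ v ∈ C, f v u + flowIn f C := by
    simp only [flowIn, ← sum_add_distrib, sum_add_sum_compl]
  have hcomm : ∑ u ∈ C, ∑ v ∈ C, f u v = ∑ u ∈ C, ∑ v ∈ C, f v u := sum_comm
  omega

/-- **Maxflow (Min+1)-cut Theorem.** An `(s,t)`-cut `C` has capacity `λ + 1` iff exactly one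
edge across `C` carries no flow and all other edges across `C` carry one unit of flow from
the `C`-side to the complement side (i.e. `f_in(C) = 0`). -/
theorem maxflow_min_plus_one_cut
    {V : Type*} [Fintype V] [DecidableEq V] (s t : V) (hst : s ≠ t)
    (w f : V → V → ℕ)
    (hsym : ∀ u v, w u v = w v u) (hwdiag : ∀ v, w v v = 0)
    (hflow : ∀ u v, f u v + f v u ≤ w u v)
    (hcons : ∀ x, x ≠ s → x ≠ t → ∑ v, f x v = ∑ v, f v x)
    (lam : ℕ)
    (hlam : IsLeast {x : ℕ | ∃ C : Finset V, s ∈ C ∧ t ∉ C ∧ capN w C = x} lam)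
    (hval : ∑ v, f s v = lam + ∑ v, f v s)
    (C : Finset V) (hCs : s ∈ C) (hCt : t ∉ C) :
    capN w C = lam + 1 ↔ zeroFlowCount w f C = 1 ∧ flowIn f C = 0 := by
  have hcap := capN_eq_flowOut_add_flowIn_add_zeroFlowCount w f hflow C
  have hnet := flowOut_eq_add_flowIn hcons hval hCs hCt
  omega
end

section
/- Second (s,t)-mincut versus global mincut (two-mincut case): Let G be a directed weighted graph on V, let f be a maximum (s,t)-flow, and suppose the only (s,t)-mincuts of G are {s} and V∖{t} (and these are distinct). Let H be the directed weighted graph on vertex set V∖{s,t} whose capacity function is the residual capacity c_f restricted to pairs of vertices of V∖{s,t}. Let C1 be a global mincut of H and let C2 be a second (s,t)-mincut of G. Then: (1) c(C2) = λ + c_H(C1); and (2) C1 ∪ {s} is a second (s,t)-mincut of G, and C2 ∖ {s} is a global mincut of H. -/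
open Finset

section Defs

variable {V : Type*} [Fintype V] [DecidableEq V]

/-- Capacity of an `(s,t)`-cut `C`. -/
def cutCapR (w : V → V → ℝ) (C : Finset V) : ℝ := ∑ u ∈ C, ∑ v ∈ Cᶜ, w u v

/-- Residual capacity of the pair `(u,v)` with respect to the flow `f`. -/
def resCapR (w f : V → V → ℝ) (u v : V) : ℝ := (w u v - f u v) + f v u

/-- A cut `C` separates `a` and `b` if exactly one of them lies in `C`. -/
def SeparatesR (C : Finset V) (a b : V) : Prop :=
  (a ∈ C ∧ b ∉ C) ∨ (b ∈ C ∧ a ∉ C)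

/-- Capacity of the global cut `A` in the graph with capacities `cw` on vertex set `U`. -/
def globCapOn (cw : V → V → ℝ) (U A : Finset V) : ℝ := ∑ u ∈ A, ∑ v ∈ U \ A, cw u v

/-- `C` is a second `(s,t)`-mincut: an `(s,t)`-cut of minimum capacity among all
`(s,t)`-cuts of capacity strictly greater than `lam`. -/
def IsSecondMincut (s t : V) (w : V → V → ℝ) (lam : ℝ) (C : Finset V) : Prop :=
  s ∈ C ∧ t ∉ C ∧ lam < cutCapR w C ∧
    ∀ D : Finset V, s ∈ D → t ∉ D → lam < cutCapR w D → cutCapR w C ≤ cutCapR w D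

/-- `A` is a global mincut of the graph with capacities `cw` on vertex set `U`. -/
def IsGlobalMincutOn (cw : V → V → ℝ) (U A : Finset V) : Prop :=
  A ⊆ U ∧ A.Nonempty ∧ A ≠ U ∧
    ∀ B : Finset V, B ⊆ U → B.Nonempty → B ≠ U → globCapOn cw U A ≤ globCapOn cw U B

end Defs

/-- Net flow across a cut: sums of `g u v - g v u` over ordered pairs inside `C` cancel. -/
theorem sum_net_eq_sum_across {V : Type*} [Fintype V] [DecidableEq V]
    (g : V → V → ℝ) (C : Finset V) :
    ∑ u ∈ C, (∑ v, g u v - ∑ v, g v u) = ∑ u ∈ C, ∑ v ∈ Cᶜ, (g u v - g v u) := by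
  have h (u : V) : ∑ v, g u v - ∑ v, g v u =
      ∑ v ∈ C, (g u v - g v u) + ∑ v ∈ Cᶜ, (g u v - g v u) := by
    rw [Finset.sum_add_sum_compl, Finset.sum_sub_distrib]
  have h0 : ∑ u ∈ C, ∑ v ∈ C, (g u v - g v u) = 0 := by
    simp only [Finset.sum_sub_distrib]
    rw [sub_eq_zero, Finset.sum_comm]
  simp only [h]
  rw [Finset.sum_add_distrib, h0, zero_add]

/-- The capacity of an `(s,t)`-cut is the flow value plus the residual capacity of the cut. -/
theorem cutCapR_eq_value_add_residual {V : Type*} [Fintype V] [DecidableEq V] {s t : V}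
    {w f : V → V → ℝ}
    (hcons : ∀ x, x ≠ s → x ≠ t → ∑ v, f x v = ∑ v, f v x)
    {C : Finset V} (hs : s ∈ C) (ht : t ∉ C) :
    cutCapR w C = (∑ v, f s v - ∑ v, f v s) + cutCapR (resCapR w f) C := by
  have h1 : ∑ u ∈ C, (∑ v, f u v - ∑ v, f v u) = ∑ v, f s v - ∑ v, f v s := by
    refine Finset.sum_eq_single_of_mem s hs fun x hx hxs => ?_
    rw [hcons x hxs (fun h => ht (h ▸ hx)), sub_self]
  rw [← h1, sum_net_eq_sum_across]
  simp only [cutCapR, resCapR, ← Finset.sum_add_distrib]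
  refine Finset.sum_congr rfl fun u _ => Finset.sum_congr rfl fun v _ => ?_
  ring

/-- If no residual capacity leaves `s` or enters `t`, then the residual capacity of an
`(s,t)`-cut is that of its trace on the remaining vertices. -/
theorem cutCapR_eq_globCapOn_sdiff {V : Type*} [Fintype V] [DecidableEq V] {s t : V}
    {r : V → V → ℝ} (hrs : ∀ v, v ≠ s → r s v = 0) (hrt : ∀ u, u ≠ t → r u t = 0)
    {C : Finset V} (hs : s ∈ C) (ht : t ∉ C) :
    cutCapR r C = globCapOn r (Finset.univ \ {s, t}) (C \ {s}) := by
  have hset : (Finset.univ \ {s, t}) \ (C \ {s}) = Cᶜ \ {t} := by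
    ext x
    simp only [Finset.mem_sdiff, Finset.mem_univ, Finset.mem_insert, Finset.mem_singleton,
      Finset.mem_compl, true_and]
    by_cases hx : x = s
    · simp [hx, hs]
    · tauto
  rw [cutCapR, globCapOn, hset]
  have hs0 : ∑ u ∈ C, ∑ v ∈ Cᶜ, r u v = ∑ u ∈ C \ {s}, ∑ v ∈ Cᶜ, r u v := by
    symm
    refine Finset.sum_subset Finset.sdiff_subset fun u hu hu' => ?_
    have hus : u = s := by simpa [hu] using hu'
    subst hus
    exact Finset.sum_eq_zero fun v hv => hrs v fun h => Finset.mem_compl.1 hv (h ▸ hu)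
  rw [hs0]
  refine Finset.sum_congr rfl fun u hu => ?_
  symm
  refine Finset.sum_subset Finset.sdiff_subset fun v hv hv' => ?_
  have hvt : v = t := by simpa [Finset.mem_compl.1 hv] using hv'
  subst hvt
  exact hrt u fun h => ht (h ▸ (Finset.mem_sdiff.1 hu).1)

/-- **Second `(s,t)`-mincut versus global mincut (two-mincut case).** If the only
`(s,t)`-mincuts of `G` are `{s}` and `V∖{t}` (distinct), `H` is the residual graph restricted
to `V∖{s,t}`, `C1` a global mincut of `H` and `C2` a second `(s,t)`-mincut of `G`, then
`c(C2) = λ + c_H(C1)`, `C1 ∪ {s}` is a second `(s,t)`-mincut of `G`, and `C2 ∖ {s}` is a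
global mincut of `H`. -/
theorem second_mincut_vs_global_mincut_two_mincut_case
    {V : Type*} [Fintype V] [DecidableEq V] (s t : V) (hst : s ≠ t)
    (w f : V → V → ℝ)
    (hw0 : ∀ u v, 0 ≤ w u v) (hwdiag : ∀ v, w v v = 0)
    (hf0 : ∀ u v, 0 ≤ f u v) (hfw : ∀ u v, f u v ≤ w u v)
    (hcons : ∀ x, x ≠ s → x ≠ t → ∑ v, f x v = ∑ v, f v x)
    (lam : ℝ)
    (hlam : IsLeast {x : ℝ | ∃ C : Finset V, s ∈ C ∧ t ∉ C ∧ cutCapR w C = x} lam)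
    (hmax : (∑ v, f s v) - (∑ v, f v s) = lam)
    (hmin1 : cutCapR w {s} = lam)
    (hmin2 : cutCapR w (Finset.univ \ {t}) = lam)
    (hdistinct : ({s} : Finset V) ≠ Finset.univ \ {t})
    (honly : ∀ C : Finset V, s ∈ C → t ∉ C → cutCapR w C = lam →
      C = {s} ∨ C = Finset.univ \ {t})
    (C1 C2 : Finset V)
    (hC1 : IsGlobalMincutOn (resCapR w f) (Finset.univ \ {s, t}) C1)
    (hC2 : IsSecondMincut s t w lam C2) :
    cutCapR w C2 = lam + globCapOn (resCapR w f) (Finset.univ \ {s, t}) C1 ∧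
    IsSecondMincut s t w lam (C1 ∪ {s}) ∧
    IsGlobalMincutOn (resCapR w f) (Finset.univ \ {s, t}) (C2 \ {s}) := by
  have hst' : t ≠ s := hst.symm
  have hnn : ∀ u v, 0 ≤ resCapR w f u v := fun u v =>
    add_nonneg (sub_nonneg.2 (hfw u v)) (hf0 v u)
  have hres : ∀ C : Finset V, s ∈ C → t ∉ C →
      cutCapR w C = lam + cutCapR (resCapR w f) C := fun C hs ht => by
    rw [cutCapR_eq_value_add_residual hcons hs ht, hmax]
  have hzero : ∀ C : Finset V, s ∈ C → t ∉ C → cutCapR w C = lam →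
      ∀ u ∈ C, ∀ v ∈ Cᶜ, resCapR w f u v = 0 := fun C hs ht hC u hu v hv => by
    have h0 : ∑ u ∈ C, ∑ v ∈ Cᶜ, resCapR w f u v = 0 := by
      have := hres C hs ht
      rw [cutCapR.eq_1 (resCapR w f)] at this
      linarith
    have h1 := (Finset.sum_eq_zero_iff_of_nonneg fun u _ =>
      Finset.sum_nonneg fun v _ => hnn u v).1 h0 u hu
    exact (Finset.sum_eq_zero_iff_of_nonneg fun v _ => hnn u v).1 h1 v hv
  have hrs : ∀ v, v ≠ s → resCapR w f s v = 0 := fun v hv =>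
    hzero {s} (by simp) (by simpa using hst') hmin1 s (by simp) v (by simpa using hv)
  have hrt : ∀ u, u ≠ t → resCapR w f u t = 0 := fun u hu =>
    hzero (Finset.univ \ {t}) (by simpa using hst) (by simp) hmin2 u (by simpa using hu) t
      (by simp)
  have hcap : ∀ C : Finset V, s ∈ C → t ∉ C → cutCapR w C =
      lam + globCapOn (resCapR w f) (Finset.univ \ {s, t}) (C \ {s}) := fun C hs ht => by
    rw [hres C hs ht, cutCapR_eq_globCapOn_sdiff hrs hrt hs ht]
  have hglob : ∀ C : Finset V, s ∈ C → t ∉ C → lam < cutCapR w C →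
      C \ {s} ⊆ Finset.univ \ {s, t} ∧ (C \ {s}).Nonempty ∧
        C \ {s} ≠ Finset.univ \ {s, t} := fun C hs ht hlt => by
    refine ⟨fun x hx => ?_, ?_, fun h => ?_⟩
    · obtain ⟨hxC, hxs⟩ := Finset.mem_sdiff.1 hx
      have hxt : x ≠ t := fun h => ht (h ▸ hxC)
      simpa [hxt] using hxs
    · rw [Finset.nonempty_iff_ne_empty]
      intro h
      have hC : C = {s} :=
        (Finset.sdiff_eq_empty_iff_subset.1 h).antisymm (Finset.singleton_subset_iff.2 hs)
      exact hlt.ne' (hC ▸ hmin1)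
    · have hC : C = Finset.univ \ {t} := by
        ext x
        have hx := Finset.ext_iff.1 h x
        by_cases hxs : x = s
        · simp [hxs, hs, hst]
        · simpa [hxs] using hx
      exact hlt.ne' (hC ▸ hmin2)
  have hcut : ∀ A : Finset V, A ⊆ Finset.univ \ {s, t} → A.Nonempty →
      A ≠ Finset.univ \ {s, t} →
      s ∈ A ∪ {s} ∧ t ∉ A ∪ {s} ∧ lam < cutCapR w (A ∪ {s}) ∧
        cutCapR w (A ∪ {s}) = lam + globCapOn (resCapR w f) (Finset.univ \ {s, t}) A :=
    fun A hA hne hneU => by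
    have hsA : s ∉ A := fun h => by simpa using hA h
    have htA : t ∉ A := fun h => by simpa using hA h
    have hs : s ∈ A ∪ {s} := by simp
    have ht : t ∉ A ∪ {s} := by simp [htA, hst']
    have hsd : (A ∪ {s}) \ {s} = A := by
      rw [Finset.union_sdiff_right, Finset.sdiff_eq_self_of_disjoint (by simpa using hsA)]
    refine ⟨hs, ht, lt_of_le_of_ne (hlam.2 ⟨_, hs, ht, rfl⟩) fun h => ?_, ?_⟩
    · rcases honly _ hs ht h.symm with h | h
      · rw [h, Finset.sdiff_self] at hsd
        exact hne.ne_empty hsd.symm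
      · rw [h, sdiff_sdiff_left] at hsd
        refine hneU (hsd.symm.trans ?_)
        congr 1
        ext x
        simp [or_comm]
    · rw [hcap _ hs ht, hsd]
  obtain ⟨hA, hne, hneU, hCmin⟩ := hC1
  obtain ⟨hs2, ht2, hlt2, hmin⟩ := hC2
  obtain ⟨hs1, ht1, hlt1, heq1⟩ := hcut C1 hA hne hneU
  obtain ⟨hA2, hne2, hneU2⟩ := hglob C2 hs2 ht2 hlt2
  have hval : cutCapR w C2 = cutCapR w (C1 ∪ {s}) := by
    refine (hmin _ hs1 ht1 hlt1).antisymm ?_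
    rw [heq1, hcap C2 hs2 ht2]
    exact add_le_add_right (hCmin _ hA2 hne2 hneU2) lam
  refine ⟨hval.trans heq1, ⟨hs1, ht1, hlt1, fun D hs ht hlt => hval ▸ hmin D hs ht hlt⟩,
    hA2, hne2, hneU2, fun B hB hBne hBU => ?_⟩
  have h2 := hcap C2 hs2 ht2
  have := hCmin B hB hBne hBU
  linarith
end

section
/- A second (s,t)-mincut subdivides at most one node of the Picard–Queyranne partition: Let G be a directed weighted graph on V and let C be a second (s,t)-mincut of G. Suppose u1, u2 ∈ C and v1, v2 ∉ C are vertices such that no (s,t)-mincut of G separates u1 and v1 and no (s,t)-mincut of G separates u2 and v2. Then no (s,t)-mincut of G separates u1 and u2 (hence all of u1, v1, u2, v2 lie in a single equivalence class of the relation 'not separated by any (s,t)-mincut'). -/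
open Finset

theorem cutCapR_eq_sum_ite {V : Type*} [Fintype V] [DecidableEq V] (w : V → V → ℝ)
    (A : Finset V) : cutCapR w A = ∑ u, ∑ v, if u ∈ A ∧ v ∉ A then w u v else 0 := by
  simp_rw [cutCapR, ite_and, Finset.sum_ite_irrel, Finset.sum_const_zero, ← Finset.mem_compl,
    Finset.sum_ite_mem, Finset.univ_inter]

/-- The cut function of a nonnegatively weighted directed graph is submodular. -/
theorem cutCapR_inter_add_cutCapR_union_le {V : Type*} [Fintype V] [DecidableEq V]
    {w : V → V → ℝ} (hw0 : ∀ u v, 0 ≤ w u v) (A B : Finset V) :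
    cutCapR w (A ∩ B) + cutCapR w (A ∪ B) ≤ cutCapR w A + cutCapR w B := by
  simp only [cutCapR_eq_sum_ite, ← Finset.sum_add_distrib]
  refine Finset.sum_le_sum fun u _ => Finset.sum_le_sum fun v _ => ?_
  have := hw0 u v
  by_cases huA : u ∈ A <;> by_cases huB : u ∈ B <;> by_cases hvA : v ∈ A <;>
    by_cases hvB : v ∈ B <;> simp [*]

/-- Two nodes subdivided by a second mincut `C` cannot lie on opposite sides of a mincut `M`:
otherwise both `C ∩ M` and `C ∪ M` have capacity at least that of `C`, which contradicts
submodularity. -/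
theorem IsSecondMincut.not_mem_and_notMem {V : Type*} [Fintype V] [DecidableEq V]
    {s t : V} {w : V → V → ℝ} (hw0 : ∀ u v, 0 ≤ w u v) {lam : ℝ}
    (hlam : ∀ D : Finset V, s ∈ D → t ∉ D → lam ≤ cutCapR w D)
    {C : Finset V} (hC : IsSecondMincut s t w lam C) {u1 u2 v1 v2 : V}
    (hu1 : u1 ∈ C) (hu2 : u2 ∈ C) (hv1 : v1 ∉ C) (hv2 : v2 ∉ C)
    (h1 : ∀ M : Finset V, s ∈ M → t ∉ M → cutCapR w M = lam → ¬ SeparatesR M u1 v1)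
    (h2 : ∀ M : Finset V, s ∈ M → t ∉ M → cutCapR w M = lam → ¬ SeparatesR M u2 v2)
    {M : Finset V} (hsM : s ∈ M) (htM : t ∉ M) (hM : cutCapR w M = lam) :
    ¬ (u1 ∈ M ∧ u2 ∉ M) := by
  rintro ⟨hu1M, hu2M⟩
  obtain ⟨hsC, htC, hltC, hminC⟩ := hC
  have hv2M : v2 ∉ M := fun h => h2 M hsM htM hM (Or.inr ⟨h, hu2M⟩)
  have hsI : s ∈ C ∩ M := Finset.mem_inter.2 ⟨hsC, hsM⟩
  have htI : t ∉ C ∩ M := fun h => htM (Finset.mem_inter.1 h).2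
  have hsU : s ∈ C ∪ M := Finset.mem_union_left M hsC
  have htU : t ∉ C ∪ M := by simp [htC, htM]
  have hI : cutCapR w C ≤ cutCapR w (C ∩ M) :=
    hminC _ hsI htI <| (hlam _ hsI htI).lt_of_ne fun h =>
      h1 _ hsI htI h.symm (Or.inl ⟨by simp [hu1, hu1M], by simp [hv1]⟩)
  have hU : cutCapR w C ≤ cutCapR w (C ∪ M) :=
    hminC _ hsU htU <| (hlam _ hsU htU).lt_of_ne fun h =>
      h2 _ hsU htU h.symm (Or.inl ⟨by simp [hu2], by simp [hv2, hv2M]⟩)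
  linarith [cutCapR_inter_add_cutCapR_union_le hw0 C M]

/-- A second `(s,t)`-mincut subdivides at most one node of the Picard–Queyranne partition:
if no `(s,t)`-mincut separates `u1` from `v1` nor `u2` from `v2`, where `u1, u2 ∈ C` and
`v1, v2 ∉ C` for a second `(s,t)`-mincut `C`, then no `(s,t)`-mincut separates `u1` and
`u2`. -/
theorem second_mincut_subdivides_at_most_one_node
    {V : Type*} [Fintype V] [DecidableEq V] (s t : V) (hst : s ≠ t)
    (w : V → V → ℝ)
    (hw0 : ∀ u v, 0 ≤ w u v) (hwdiag : ∀ v, w v v = 0)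
    (lam : ℝ)
    (hlam : IsLeast {x : ℝ | ∃ C : Finset V, s ∈ C ∧ t ∉ C ∧ cutCapR w C = x} lam)
    (C : Finset V) (hC : IsSecondMincut s t w lam C)
    (u1 u2 v1 v2 : V)
    (hu1 : u1 ∈ C) (hu2 : u2 ∈ C) (hv1 : v1 ∉ C) (hv2 : v2 ∉ C)
    (h1 : ∀ M : Finset V, s ∈ M → t ∉ M → cutCapR w M = lam → ¬ SeparatesR M u1 v1)
    (h2 : ∀ M : Finset V, s ∈ M → t ∉ M → cutCapR w M = lam → ¬ SeparatesR M u2 v2) :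
    ∀ M : Finset V, s ∈ M → t ∉ M → cutCapR w M = lam → ¬ SeparatesR M u1 u2 := by
  have hmin : ∀ D : Finset V, s ∈ D → t ∉ D → lam ≤ cutCapR w D :=
    fun D hsD htD => hlam.2 ⟨D, hsD, htD, rfl⟩
  rintro M hsM htM hM (h | h)
  · exact hC.not_mem_and_notMem hw0 hmin hu1 hu2 hv1 hv2 h1 h2 hsM htM hM h
  · exact hC.not_mem_and_notMem hw0 hmin hu2 hu1 hv2 hv1 h2 h1 hsM htM hM h
end

section
/- Let H be a directed weighted graph on a finite vertex set U with |U| ≥ 2, let s ∈ U, and let W ∈ ℝ with W > ∑_{u,v∈U} w(u,v). Let H_s be the directed weighted graph on U obtained from H by adding, for every vertex v ≠ s, an arc (v,s) of capacity W (i.e., w_s(v,s) = w(v,s) + W for v ≠ s, and w_s(u,v) = w(u,v) for all other pairs). Then every global mincut C of H_s satisfies s ∈ C and c_{H_s}(C) = c_H(C). -/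
open Finset

section Defs

variable {U : Type*} [Fintype U] [DecidableEq U]

/-- Capacity of the global cut `A`. -/
def gcap (w : U → U → ℝ) (A : Finset U) : ℝ := ∑ u ∈ A, ∑ v ∈ Aᶜ, w u v

/-- The graph `H_s`: for every vertex `v ≠ s`, an arc `(v, s)` of capacity `W` is added. -/
def addBackW (s : U) (w : U → U → ℝ) (W : ℝ) : U → U → ℝ :=
  fun u v => if v = s ∧ u ≠ s then w u v + W else w u v

end Defs

lemma gcap_le_sum {U : Type*} [Fintype U] [DecidableEq U] {w : U → U → ℝ}
    (hw0 : ∀ u v, 0 ≤ w u v) (A : Finset U) : gcap w A ≤ ∑ u, ∑ v, w u v :=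
  calc gcap w A ≤ ∑ u ∈ A, ∑ v, w u v :=
        sum_le_sum fun u _ => sum_le_sum_of_subset_of_nonneg (subset_univ _)
          fun v _ _ => hw0 u v
    _ ≤ ∑ u, ∑ v, w u v :=
        sum_le_sum_of_subset_of_nonneg (subset_univ _)
          fun u _ _ => sum_nonneg fun v _ => hw0 u v

lemma gcap_addBackW_of_mem {U : Type*} [Fintype U] [DecidableEq U] {s : U} {A : Finset U}
    (hs : s ∈ A) (w : U → U → ℝ) (W : ℝ) : gcap (addBackW s w W) A = gcap w A := by
  refine sum_congr rfl fun u _ => sum_congr rfl fun v hv => if_neg ?_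
  rintro ⟨rfl, -⟩
  exact mem_compl.mp hv hs

lemma le_gcap_addBackW_of_notMem {U : Type*} [Fintype U] [DecidableEq U] {s : U} {A : Finset U}
    (hs : s ∉ A) (hA : A.Nonempty) {w : U → U → ℝ} (hw0 : ∀ u v, 0 ≤ w u v) {W : ℝ}
    (hW : 0 ≤ W) : W ≤ gcap (addBackW s w W) A := by
  have hnonneg : ∀ u v, 0 ≤ addBackW s w W u v := fun u v => by
    unfold addBackW
    split_ifs
    · exact add_nonneg (hw0 u v) hW
    · exact hw0 u v
  obtain ⟨a, ha⟩ := hA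
  have has : a ≠ s := fun h => hs (h ▸ ha)
  calc W ≤ addBackW s w W a s := by simp [addBackW, has, hw0 a s]
    _ ≤ ∑ v ∈ Aᶜ, addBackW s w W a v :=
        single_le_sum (f := fun v => addBackW s w W a v) (fun v _ => hnonneg a v)
          (mem_compl.mpr hs)
    _ ≤ gcap (addBackW s w W) A :=
        single_le_sum (f := fun u => ∑ v ∈ Aᶜ, addBackW s w W u v)
          (fun u _ => sum_nonneg fun v _ => hnonneg u v) ha

/-- Every global mincut `C` of `H_s` contains `s` and satisfies `c_{H_s}(C) = c_H(C)`. -/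
theorem global_mincut_of_Hs
    {U : Type*} [Fintype U] [DecidableEq U] (s : U)
    (hcard : 2 ≤ Fintype.card U)
    (w : U → U → ℝ) (hw0 : ∀ u v, 0 ≤ w u v) (hwdiag : ∀ v, w v v = 0)
    (W : ℝ) (hW : (∑ u, ∑ v, w u v) < W) :
    ∀ C : Finset U, C.Nonempty → C ≠ Finset.univ →
      (∀ B : Finset U, B.Nonempty → B ≠ Finset.univ →
        gcap (addBackW s w W) C ≤ gcap (addBackW s w W) B) →
      s ∈ C ∧ gcap (addBackW s w W) C = gcap w C := by
  intro C hC _ hmin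
  have hs : s ∈ C := by
    by_contra hs
    have hWnonneg : 0 ≤ W :=
      (sum_nonneg fun u _ => sum_nonneg fun v _ => hw0 u v).trans hW.le
    have hne : ({s} : Finset U) ≠ Finset.univ := fun h => by
      have hc := congrArg Finset.card h
      rw [card_singleton, card_univ] at hc
      omega
    have hle := hmin {s} (singleton_nonempty s) hne
    rw [gcap_addBackW_of_mem (mem_singleton_self s)] at hle
    linarith [gcap_le_sum hw0 {s}, le_gcap_addBackW_of_notMem hs hC hw0 hWnonneg]
  exact ⟨hs, gcap_addBackW_of_mem hs w W⟩
end

section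
/- Second (s,t)-mincut versus global mincut (unique-mincut case): Let G be a directed weighted graph on V, f a maximum (s,t)-flow, and suppose V∖{t} is the unique (s,t)-mincut of G. Let H be the directed weighted graph on U = V∖{t} whose capacity function is the residual capacity c_f restricted to pairs of vertices of U, let W ∈ ℝ with W > ∑_{u,v∈U} c_f(u,v), and let H_s be obtained from H by adding an arc (v,s) of capacity W for every v ∈ U∖{s}. Let C1 be a global mincut of H_s and C2 a second (s,t)-mincut of G. Then: (1) c(C2) = λ + c_{H_s}(C1); and (2) C1 is a second (s,t)-mincut of G, and C2 is a global mincut of H_s. -/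
open Finset

/-- The graph `H_s`: capacities are residual capacities, and for every vertex `v ≠ s` an arc
`(v, s)` of capacity `W` is added. -/
def cHs {V : Type*} [DecidableEq V] (s : V) (w f : V → V → ℝ) (W : ℝ) : V → V → ℝ :=
  fun u v => if v = s ∧ u ≠ s then resCapR w f u v + W else resCapR w f u v

/-- The residual capacity of a cut is its capacity minus the value of the flow. -/
theorem cutCapR_resCapR {V : Type*} [Fintype V] [DecidableEq V] {s t : V} (w f : V → V → ℝ)
    (hcons : ∀ x, x ≠ s → x ≠ t → ∑ v, f x v = ∑ v, f v x)
    {C : Finset V} (hs : s ∈ C) (ht : t ∉ C) :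
    cutCapR (resCapR w f) C = cutCapR w C - ((∑ v, f s v) - ∑ v, f v s) := by
  have hnet : ∑ u ∈ C, ((∑ v, f u v) - ∑ v, f v u) = (∑ v, f s v) - ∑ v, f v s := by
    refine Finset.sum_eq_single_of_mem s hs fun x hx hxs => ?_
    rw [hcons x hxs (fun h => ht (h ▸ hx)), sub_self]
  have hinner : ∑ u ∈ C, ∑ v ∈ C, f u v = ∑ u ∈ C, ∑ v ∈ C, f v u := Finset.sum_comm
  have hout : ∑ u ∈ C, ∑ v, f u v = ∑ u ∈ C, ∑ v ∈ C, f u v + ∑ u ∈ C, ∑ v ∈ Cᶜ, f u v := by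
    simp_rw [← Finset.sum_add_distrib, Finset.sum_add_sum_compl]
  have hin : ∑ u ∈ C, ∑ v, f v u = ∑ u ∈ C, ∑ v ∈ C, f v u + ∑ u ∈ C, ∑ v ∈ Cᶜ, f v u := by
    simp_rw [← Finset.sum_add_distrib, Finset.sum_add_sum_compl]
  rw [Finset.sum_sub_distrib] at hnet
  simp only [cutCapR, resCapR, Finset.sum_add_distrib, Finset.sum_sub_distrib]
  linarith

/-- A global cut containing `s` is not crossed by the added arcs. -/
theorem globCapOn_cHs_of_mem {V : Type*} [Fintype V] [DecidableEq V] {s : V} (w f : V → V → ℝ)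
    (W : ℝ) (U : Finset V) {A : Finset V} (hs : s ∈ A) :
    globCapOn (cHs s w f W) U A = globCapOn (resCapR w f) U A := by
  refine Finset.sum_congr rfl fun u _ => Finset.sum_congr rfl fun v hv => ?_
  have hvs : v ≠ s := fun h => (Finset.mem_sdiff.1 hv).2 (h ▸ hs)
  simp [cHs, hvs]

/-- A nonempty global cut avoiding `s` is crossed by an added arc. -/
theorem le_globCapOn_cHs_of_notMem {V : Type*} [Fintype V] [DecidableEq V] {s : V}
    {w f : V → V → ℝ} (hres : ∀ u v, 0 ≤ resCapR w f u v) {W : ℝ} (hW : 0 ≤ W)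
    {U A : Finset V} (hsU : s ∈ U) (hA : A.Nonempty) (hs : s ∉ A) :
    W ≤ globCapOn (cHs s w f W) U A := by
  have hnonneg : ∀ u v, 0 ≤ cHs s w f W u v := by
    intro u v
    unfold cHs
    split_ifs
    · exact add_nonneg (hres u v) hW
    · exact hres u v
  obtain ⟨a, ha⟩ := hA
  have has : a ≠ s := fun h => hs (h ▸ ha)
  calc W ≤ cHs s w f W a s := by simpa [cHs, has] using hres a s
    _ ≤ ∑ v ∈ U \ A, cHs s w f W a v :=
      Finset.single_le_sum (fun v _ => hnonneg a v) (Finset.mem_sdiff.2 ⟨hsU, hs⟩)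
    _ ≤ globCapOn (cHs s w f W) U A :=
      Finset.single_le_sum (f := fun u => ∑ v ∈ U \ A, cHs s w f W u v)
        (fun u _ => Finset.sum_nonneg fun v _ => hnonneg u v) ha

/-- If no arc of positive capacity leads from `A` to `t`, then `t` may be removed from the graph
without changing the capacity of the cut `A`. -/
theorem globCapOn_sdiff_singleton {V : Type*} [Fintype V] [DecidableEq V] {t : V}
    {c : V → V → ℝ} {A : Finset V} (ht : t ∉ A) (hc : ∀ u ∈ A, c u t = 0) :
    globCapOn c (Finset.univ \ {t}) A = cutCapR c A := by
  refine Finset.sum_congr rfl fun u hu => ?_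
  refine Finset.sum_subset (fun v hv => ?_) fun v hv hv' => ?_
  · exact Finset.mem_compl.2 (Finset.mem_sdiff.1 hv).2
  · obtain rfl : v = t := by
      by_contra h
      exact hv' (by simpa [h] using hv)
    exact hc u hu

theorem globCapOn_le_sum {V : Type*} [DecidableEq V] {c : V → V → ℝ} (hc : ∀ u v, 0 ≤ c u v)
    {U A : Finset V} (hA : A ⊆ U) : globCapOn c U A ≤ ∑ u ∈ U, ∑ v ∈ U, c u v :=
  (Finset.sum_le_sum fun u _ => Finset.sum_le_sum_of_subset_of_nonneg Finset.sdiff_subset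
    fun v _ _ => hc u v).trans
  (Finset.sum_le_sum_of_subset_of_nonneg hA fun u _ _ => Finset.sum_nonneg fun v _ => hc u v)

/-- **Second `(s,t)`-mincut versus global mincut (unique-mincut case).** If `V∖{t}` is the
unique `(s,t)`-mincut of `G`, `C1` is a global mincut of `H_s` (residual graph on `V∖{t}`
with heavy arcs into `s` added) and `C2` a second `(s,t)`-mincut of `G`, then
`c(C2) = λ + c_{H_s}(C1)`, `C1` is a second `(s,t)`-mincut of `G`, and `C2` is a global
mincut of `H_s`. -/
theorem second_mincut_vs_global_mincut_unique_mincut_case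
    {V : Type*} [Fintype V] [DecidableEq V] (s t : V) (hst : s ≠ t)
    (w f : V → V → ℝ)
    (hw0 : ∀ u v, 0 ≤ w u v) (hwdiag : ∀ v, w v v = 0)
    (hf0 : ∀ u v, 0 ≤ f u v) (hfw : ∀ u v, f u v ≤ w u v)
    (hcons : ∀ x, x ≠ s → x ≠ t → ∑ v, f x v = ∑ v, f v x)
    (lam : ℝ)
    (hlam : IsLeast {x : ℝ | ∃ C : Finset V, s ∈ C ∧ t ∉ C ∧ cutCapR w C = x} lam)
    (hmax : (∑ v, f s v) - (∑ v, f v s) = lam)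
    (huniq : ∀ C : Finset V, s ∈ C → t ∉ C →
      (cutCapR w C = lam ↔ C = Finset.univ \ {t}))
    (W : ℝ)
    (hW : (∑ u ∈ Finset.univ \ {t}, ∑ v ∈ Finset.univ \ {t}, resCapR w f u v) < W)
    (C1 C2 : Finset V)
    (hC1 : IsGlobalMincutOn (cHs s w f W) (Finset.univ \ {t}) C1)
    (hC2 : IsSecondMincut s t w lam C2) :
    cutCapR w C2 = lam + globCapOn (cHs s w f W) (Finset.univ \ {t}) C1 ∧
    IsSecondMincut s t w lam C1 ∧
    IsGlobalMincutOn (cHs s w f W) (Finset.univ \ {t}) C2 := by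
  set U : Finset V := Finset.univ \ {t} with hU
  have hsU : s ∈ U := by simp [hU, hst]
  have htU : t ∉ U := by simp [hU]
  have hsub : ∀ D : Finset V, t ∉ D → D ⊆ U := fun D hD v hv => by
    have : v ≠ t := fun h => hD (h ▸ hv)
    simp [hU, this]
  have hres : ∀ u v, 0 ≤ resCapR w f u v := fun u v =>
    add_nonneg (sub_nonneg.2 (hfw u v)) (hf0 v u)
  have hres_t : ∀ u ∈ U, resCapR w f u t = 0 := by
    have hzero : cutCapR (resCapR w f) U = 0 := by
      rw [cutCapR_resCapR w f hcons hsU htU, hmax, (huniq U hsU htU).2 rfl, sub_self]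
    intro u hu
    have h := (Finset.sum_eq_zero_iff_of_nonneg
      fun u _ => Finset.sum_nonneg fun v _ => hres u v).1 hzero u hu
    exact (Finset.sum_eq_zero_iff_of_nonneg fun v _ => hres u v).1 h t (by simp [htU])
  have hcap : ∀ D : Finset V, s ∈ D → t ∉ D →
      globCapOn (cHs s w f W) U D = cutCapR w D - lam := fun D hs ht => by
    rw [globCapOn_cHs_of_mem w f W U hs, hU,
      globCapOn_sdiff_singleton ht fun u hu => hres_t u (hsub D ht hu),
      cutCapR_resCapR w f hcons hs ht, hmax]
  have hlt : ∀ D : Finset V, s ∈ D → t ∉ D → (lam < cutCapR w D ↔ D ≠ U) := fun D hs ht => by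
    rw [Ne, ← huniq D hs ht]
    exact ⟨fun h => h.ne', fun h => lt_of_le_of_ne (hlam.2 ⟨D, hs, ht, rfl⟩) (Ne.symm h)⟩
  obtain ⟨hC1U, hC1ne, hC1ne', hC1min⟩ := hC1
  obtain ⟨hs2, ht2, hlt2, hC2min⟩ := hC2
  have hC2U := hsub C2 ht2
  have hC2ne := (hlt C2 hs2 ht2).1 hlt2
  have hC2W : globCapOn (cHs s w f W) U C2 < W := by
    rw [globCapOn_cHs_of_mem w f W U hs2]
    exact (globCapOn_le_sum hres hC2U).trans_lt hW
  have hW0 : 0 ≤ W :=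
    (Finset.sum_nonneg fun u _ => Finset.sum_nonneg fun v _ => hres u v).trans hW.le
  have hC12 := hC1min C2 hC2U ⟨s, hs2⟩ hC2ne
  have hs1 : s ∈ C1 := by
    by_contra hs
    exact absurd (le_globCapOn_cHs_of_notMem hres hW0 hsU hC1ne hs) (by linarith)
  have ht1 : t ∉ C1 := fun h => htU (hC1U h)
  have hlt1 := (hlt C1 hs1 ht1).2 hC1ne'
  have hC21 := hC2min C1 hs1 ht1 hlt1
  have hcap1 := hcap C1 hs1 ht1
  have hcap2 := hcap C2 hs2 ht2
  refine ⟨by linarith, ⟨hs1, ht1, hlt1, fun D hs ht hD => ?_⟩,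
    ⟨hC2U, ⟨s, hs2⟩, hC2ne, fun B hB hBne hBU => ?_⟩⟩
  · linarith [hC2min D hs ht hD]
  · linarith [hC1min B hB hBne hBU]
end

section
/- Residual connectivity characterization of minimum+1 cuts: Let G be a directed multigraph on V, f a maximum integral (s,t)-flow, and suppose V∖{t} is the unique (s,t)-mincut of G. Then for every vertex x ∈ V∖{s,t}: there exists an (s,t)-cut C of G with c(C) = λ + 1 and x ∉ C if and only if the minimum of ∑_{a∈D, b∉D} ĉ(a,b) over all sets D ⊆ V with s ∈ D and x ∉ D equals 1 (equivalently, by Menger's theorem, there is exactly one edge-disjoint path from s to x in the residual graph). -/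
open Finset

section Defs

variable {V : Type*} [Fintype V] [DecidableEq V]

/-- Residual capacity of the pair `(u,v)` with respect to the flow `f`. -/
def resCapN (w f : V → V → ℕ) (u v : V) : ℕ := (w u v - f u v) + f v u

end Defs

/-- In a cut `C` avoiding `t`, a flow of value `lam` crosses `C` with net amount `lam`. -/
theorem sum_flow_cut {V : Type*} [Fintype V] [DecidableEq V] {s t : V} {f : V → V → ℕ}
    (hcons : ∀ x, x ≠ s → x ≠ t → ∑ v, f x v = ∑ v, f v x) {lam : ℕ}
    (hval : ∑ v, f s v = lam + ∑ v, f v s) {C : Finset V} (hs : s ∈ C) (ht : t ∉ C) :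
    ∑ a ∈ C, ∑ b ∈ Cᶜ, f a b = lam + ∑ a ∈ C, ∑ b ∈ Cᶜ, f b a := by
  have hbalance : ∑ a ∈ C, ∑ v, f a v = lam + ∑ a ∈ C, ∑ v, f v a := by
    rw [← Finset.add_sum_erase C _ hs, ← Finset.add_sum_erase C (fun a => ∑ v, f v a) hs, hval,
      add_assoc]
    congr 2
    refine Finset.sum_congr rfl fun a ha => hcons a (Finset.ne_of_mem_erase ha) ?_
    rintro rfl
    exact ht (Finset.mem_of_mem_erase ha)
  simp only [← Finset.sum_add_sum_compl C, Finset.sum_add_distrib] at hbalance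
  have hcomm : ∑ a ∈ C, ∑ b ∈ C, f a b = ∑ a ∈ C, ∑ b ∈ C, f b a := Finset.sum_comm
  omega

/-- The residual capacity of an `(s,t)`-cut is its capacity minus the value of the flow. -/
theorem sum_resCapN_add_eq_capN {V : Type*} [Fintype V] [DecidableEq V] {s t : V}
    {w f : V → V → ℕ} (hfw : ∀ u v, f u v ≤ w u v)
    (hcons : ∀ x, x ≠ s → x ≠ t → ∑ v, f x v = ∑ v, f v x) {lam : ℕ}
    (hval : ∑ v, f s v = lam + ∑ v, f v s) {C : Finset V} (hs : s ∈ C) (ht : t ∉ C) :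
    (∑ a ∈ C, ∑ b ∈ Cᶜ, resCapN w f a b) + lam = capN w C := by
  have hnet := sum_flow_cut hcons hval hs ht
  have hsum : (∑ a ∈ C, ∑ b ∈ Cᶜ, resCapN w f a b) + ∑ a ∈ C, ∑ b ∈ Cᶜ, f a b =
      capN w C + ∑ a ∈ C, ∑ b ∈ Cᶜ, f b a := by
    simp only [capN, ← Finset.sum_add_distrib]
    refine Finset.sum_congr rfl fun a _ => Finset.sum_congr rfl fun b _ => ?_
    have := hfw a b
    simp only [resCapN]
    omega
  omega

/-- Removing from `D` a vertex without incoming arcs does not increase the capacity of `D`. -/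
theorem sum_cut_erase_le {V : Type*} [Fintype V] [DecidableEq V] {t : V} {g : V → V → ℕ}
    (hg : ∀ a, a ≠ t → g a t = 0) (D : Finset V) :
    ∑ a ∈ D.erase t, ∑ b ∈ (D.erase t)ᶜ, g a b ≤ ∑ a ∈ D, ∑ b ∈ Dᶜ, g a b := by
  by_cases ht : t ∈ D
  · calc ∑ a ∈ D.erase t, ∑ b ∈ (D.erase t)ᶜ, g a b
        = ∑ a ∈ D.erase t, ∑ b ∈ Dᶜ, g a b := by
          refine Finset.sum_congr rfl fun a ha => ?_
          rw [Finset.compl_erase, Finset.sum_insert (by simpa using ht),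
            hg a (Finset.ne_of_mem_erase ha), zero_add]
      _ ≤ ∑ a ∈ D, ∑ b ∈ Dᶜ, g a b := Finset.sum_le_sum_of_subset (Finset.erase_subset t D)
  · rw [Finset.erase_eq_of_notMem ht]

/-- **Residual connectivity characterization of minimum+1 cuts.** If `V∖{t}` is the unique
`(s,t)`-mincut, then for every `x ∉ {s,t}`: there is a `(λ+1)` `(s,t)`-cut avoiding `x` iff
the minimum residual capacity of a cut separating `s` from `x` equals `1`. -/
theorem min_plus_one_cut_iff_one_edge_disjoint_path
    {V : Type*} [Fintype V] [DecidableEq V] (s t : V) (hst : s ≠ t)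
    (w f : V → V → ℕ) (hwdiag : ∀ v, w v v = 0)
    (hfw : ∀ u v, f u v ≤ w u v)
    (hcons : ∀ x, x ≠ s → x ≠ t → ∑ v, f x v = ∑ v, f v x)
    (lam : ℕ)
    (hlam : IsLeast {x : ℕ | ∃ C : Finset V, s ∈ C ∧ t ∉ C ∧ capN w C = x} lam)
    (hval : ∑ v, f s v = lam + ∑ v, f v s)
    (huniq : ∀ C : Finset V, s ∈ C → t ∉ C →
      (capN w C = lam ↔ C = Finset.univ \ {t}))
    (x : V) (hxs : x ≠ s) (hxt : x ≠ t) :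
    (∃ C : Finset V, s ∈ C ∧ t ∉ C ∧ capN w C = lam + 1 ∧ x ∉ C) ↔
      IsLeast {y : ℕ | ∃ D : Finset V, s ∈ D ∧ x ∉ D ∧
        (∑ a ∈ D, ∑ b ∈ Dᶜ, resCapN w f a b) = y} 1 := by
  have hcap {C : Finset V} (hs : s ∈ C) (ht : t ∉ C) :=
    sum_resCapN_add_eq_capN hfw hcons hval hs ht
  have hzero : ∀ a, a ≠ t → resCapN w f a t = 0 := by
    intro a ha
    have hs : s ∈ Finset.univ \ {t} := by simpa using hst
    have ht : t ∉ Finset.univ \ {t} := by simp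
    have h := hcap hs ht
    rw [(huniq _ hs ht).2 rfl, Nat.add_eq_right] at h
    exact Finset.sum_eq_zero_iff.1 (Finset.sum_eq_zero_iff.1 h a (by simpa using ha)) t (by simp)
  have hlower {C : Finset V} (hs : s ∈ C) (ht : t ∉ C) (hx : x ∉ C) : lam + 1 ≤ capN w C := by
    refine Nat.lt_of_le_of_ne (hlam.2 ⟨C, hs, ht, rfl⟩) fun h => hx ?_
    rw [(huniq C hs ht).1 h.symm]
    simpa using hxt
  have herase {D : Finset V} (hs : s ∈ D) (hx : x ∉ D) :
      s ∈ D.erase t ∧ t ∉ D.erase t ∧ x ∉ D.erase t :=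
    ⟨Finset.mem_erase.2 ⟨hst, hs⟩, Finset.notMem_erase t D, fun h => hx (Finset.mem_of_mem_erase h)⟩
  constructor
  · rintro ⟨C, hs, ht, hC, hx⟩
    refine ⟨⟨C, hs, hx, by have := hcap hs ht; omega⟩, ?_⟩
    rintro _ ⟨D, hsD, hxD, rfl⟩
    obtain ⟨hs', ht', hx'⟩ := herase hsD hxD
    have := sum_cut_erase_le hzero D
    have := hcap hs' ht'
    have := hlower hs' ht' hx'
    omega
  · rintro ⟨⟨D, hsD, hxD, hD⟩, -⟩
    obtain ⟨hs', ht', hx'⟩ := herase hsD hxD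
    refine ⟨D.erase t, hs', ht', ?_, hx'⟩
    have := sum_cut_erase_le hzero D
    have := hcap hs' ht'
    have := hlower hs' ht' hx'
    omega
end
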